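/- Let $m \geq 2$ and let $d, q, \delta_1, \ldots, \delta_m$ be nonnegative real numbers with $d = \sum_{i=1}^m \delta_i$ and $\delta_1 \geq q$. If $(m-1)q \leq d$ then $-\delta_m q + \sum_{i<j} \delta_i \delta_j \leq -dq + \frac{m-1}{2m}(d+q)^2$, and if $(m-1)q > d$ then $-\delta_m q + \sum_{i<j} \delta_i\delta_j \leq -dq + d^2 - \frac{m-1}{2(m-2)}(d-q)^2$. -/

import Mathlib

/-- The square of a sum is the sum of the squares plus twice the sum of the products of pairs. -/
theorem sq_sum_eq_sum_sq_add_two_mul_sum_lt {ι R : Type*} [Fintype ι] [LinearOrder ι]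
    [CommRing R] (f : ι → R) :
    (∑ i, f i) ^ 2 =
      ∑ i, f i ^ 2 + 2 * ∑ i, ∑ j, if i < j then f i * f j else 0 := by
  have hswap : (∑ i, ∑ j, if i < j then f i * f j else 0) =
      ∑ i, ∑ j, if j < i then f i * f j else 0 := by
    rw [Finset.sum_comm]
    simp only [mul_comm]
  have hdiag : ∑ i, f i ^ 2 = ∑ i, ∑ j, if i = j then f i * f j else 0 := by
    simp [sq]
  rw [two_mul]
  nth_rewrite 2 [hswap]
  rw [hdiag, sq, Finset.sum_mul_sum]
  simp only [← Finset.sum_add_distrib]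
  refine Finset.sum_congr rfl fun i _ => Finset.sum_congr rfl fun j _ => ?_
  rcases lt_trichotomy i j with h | h | h
  · simp [h, h.ne, h.not_gt]
  · simp [h]
  · simp [h, h.ne', h.not_gt]


theorem stmt4 (m : ℕ) (hm : 2 ≤ m) (d q : ℝ) (δ : Fin m → ℝ)
    (hδ : ∀ i, 0 ≤ δ i) (hq : 0 ≤ q) (hd : d = ∑ i, δ i)
    (h1 : q ≤ δ ⟨0, by omega⟩) :
    (((m : ℝ) - 1) * q ≤ d →
      -δ ⟨m - 1, by omega⟩ * q +
          (∑ i : Fin m, ∑ j : Fin m, if i < j then δ i * δ j else 0) ≤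
        -d * q + ((m : ℝ) - 1) / (2 * m) * (d + q) ^ 2) ∧
    (d < ((m : ℝ) - 1) * q →
      -δ ⟨m - 1, by omega⟩ * q +
          (∑ i : Fin m, ∑ j : Fin m, if i < j then δ i * δ j else 0) ≤
        -d * q + d ^ 2 - ((m : ℝ) - 1) / (2 * ((m : ℝ) - 2)) * (d - q) ^ 2) := by
  obtain ⟨k, rfl⟩ : ∃ k, m = k + 2 := ⟨m - 2, by omega⟩
  have hpair := sq_sum_eq_sum_sq_add_two_mul_sum_lt δ
  set P := ∑ i : Fin (k + 2), ∑ j : Fin (k + 2), if i < j then δ i * δ j else 0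
  have hfirst : (⟨0, by omega⟩ : Fin (k + 2)) = 0 := rfl
  have hlast : (⟨k + 2 - 1, by omega⟩ : Fin (k + 2)) = Fin.succ (Fin.last k) := rfl
  rw [hfirst] at h1
  rw [hlast]
  rw [← hd] at hpair
  have hx := hδ 0
  have hy := hδ (Fin.succ (Fin.last k))
  have hz : ∀ i : Fin k, 0 ≤ δ (Fin.succ (Fin.castSucc i)) := fun i => hδ _
  rw [Fin.sum_univ_succ, Fin.sum_univ_castSucc] at hd hpair
  have hcs : (∑ i : Fin k, δ (Fin.succ (Fin.castSucc i))) ^ 2 ≤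
      k * ∑ i : Fin k, δ (Fin.succ (Fin.castSucc i)) ^ 2 := by
    simpa using sq_sum_le_card_mul_sum_sq (s := Finset.univ)
      (f := fun i : Fin k => δ (Fin.succ (Fin.castSucc i)))
  have hs : 0 ≤ ∑ i : Fin k, δ (Fin.succ (Fin.castSucc i)) :=
    Finset.sum_nonneg fun i _ => hz i
  have hcs' : (d + q) ^ 2 ≤ ((k : ℝ) + 2) *
      (δ 0 ^ 2 + (δ (Fin.succ (Fin.last k)) + q) ^ 2 +
        ∑ i : Fin k, δ (Fin.succ (Fin.castSucc i)) ^ 2) := by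
    have h := sq_sum_le_card_mul_sum_sq (s := Finset.univ)
      (f := fun i : Fin (k + 2) => δ i + if i = Fin.succ (Fin.last k) then q else 0)
    rw [Fin.sum_univ_succ, Fin.sum_univ_castSucc, Fin.sum_univ_succ, Fin.sum_univ_castSucc] at h
    have h0 : (0 : Fin (k + 2)) ≠ Fin.succ (Fin.last k) := (Fin.succ_ne_zero _).symm
    simp only [Fin.succ_inj, (Fin.castSucc_lt_last _).ne, h0, if_true, if_false, add_zero,
      Finset.card_univ, Fintype.card_fin] at h
    push_cast at h
    rw [hd]
    linarith
  generalize δ 0 = x at *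
  generalize δ (Fin.succ (Fin.last k)) = y at *
  generalize ∑ i : Fin k, δ (Fin.succ (Fin.castSucc i)) = s at *
  generalize ∑ i : Fin k, δ (Fin.succ (Fin.castSucc i)) ^ 2 = S at *
  clear_value P
  push_cast
  refine ⟨fun _ => ?_, fun hlt => ?_⟩
  · have hk : (0 : ℝ) < (k : ℝ) + 2 := by positivity
    have hdiv : (d + q) ^ 2 / ((k : ℝ) + 2) ≤ x ^ 2 + (y + q) ^ 2 + S := by
      rw [div_le_iff₀ hk]
      linarith
    have hid : ((k : ℝ) + 2 - 1) / (2 * (k + 2)) * (d + q) ^ 2 =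
        (d + q) ^ 2 / 2 - (d + q) ^ 2 / (k + 2) / 2 := by
      field_simp
    rw [hid]
    linarith
  · have hk : (0 : ℝ) < k := by
      rcases Nat.eq_zero_or_pos k with rfl | h
      · norm_num at hlt
        linarith
      · exact_mod_cast h
    have hsq : (d - q) ^ 2 ≤ k * (x ^ 2 + (y + q) ^ 2 + S - 2 * q ^ 2) := by
      have hb : d - q ≤ k * q := by linarith
      have ha : 0 ≤ x - q + y := by linarith
      have hmul : (x - q + y) * (2 * (d - q)) ≤ (x - q + y) * (2 * (k * q)) := by gcongr
      have hds : (d - q) ^ 2 - s ^ 2 = (x - q + y) * (2 * (d - q)) - (x - q + y) ^ 2 := by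
        rw [hd]
        ring
      have := mul_nonneg hk.le (add_nonneg (sq_nonneg (x - q)) (sq_nonneg y))
      nlinarith [sq_nonneg (x - q + y)]
    have hdiv : (d - q) ^ 2 / (k : ℝ) ≤ x ^ 2 + (y + q) ^ 2 + S - 2 * q ^ 2 := by
      rw [div_le_iff₀ hk]
      linarith
    have hid : ((k : ℝ) + 2 - 1) / (2 * (k + 2 - 2)) * (d - q) ^ 2 =
        (d - q) ^ 2 / 2 + (d - q) ^ 2 / k / 2 := by
      rw [add_sub_cancel_right]
      field_simp
      ring
    rw [hid]
    linarith
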